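/- Let f be a minmax monotone cost function on a finite tree T_in, let 𝒯 ≥ 0, and let T = (V,E) be a working subtree with sink set S ⊆ V whose elements are leaves of T. If no ordered pair (u,v) ∈ V × V satisfies the peaking criterion and S = {s} for a single sink s, then f(V, s) ≤ 𝒯. -/

import Mathlib

open SimpleGraph Set
open scoped ENNReal

variable {V : Type*}

/-- The vertex set of the connected component of the subgraph of `G` induced on `A`
containing the vertex `u` (empty if `u ∉ A`). -/
def reachSet (G : SimpleGraph V) (A : Set V) (u : V) : Set V :=
  {y | ∃ (hu : u ∈ A) (hy : y ∈ A), (G.induce A).Reachable ⟨u, hu⟩ ⟨y, hy⟩}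

/-- `U` is a subtree: the induced subgraph on `U` is connected. -/
def IsSubtree (G : SimpleGraph V) (U : Set V) : Prop :=
  (G.induce U).Connected

/-- A minmax monotone cost function on the tree `G`:
`f {s} s = 0`; `f U s = ∞` if `U` is not a subtree or `s ∉ U`; set monotonicity;
path monotonicity; and max tree composition (the slices of `U` defined by `s` being the
connected components of `U \ {s}`). -/
structure IsMinmaxMonotone (G : SimpleGraph V) (f : Set V → V → ℝ≥0∞) : Prop where
  singleton_eq_zero : ∀ s : V, f {s} s = 0
  eq_top_of_not_subtree : ∀ (U : Set V) (s : V), ¬ IsSubtree G U → f U s = ⊤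
  eq_top_of_not_mem : ∀ (U : Set V) (s : V), s ∉ U → f U s = ⊤
  set_mono : ∀ (U₁ U₂ : Set V) (s : V), IsSubtree G U₁ → IsSubtree G U₂ →
    s ∈ U₁ → U₁ ⊆ U₂ → f U₁ s ≤ f U₂ s
  path_mono : ∀ (U : Set V) (s u : V), IsSubtree G U → s ∉ U → u ∈ U → G.Adj s u →
    f U u ≤ f (U ∪ {s}) s
  max_comp : ∀ (U : Set V) (s : V), IsSubtree G U → s ∈ U →
    f U s = ⨆ x ∈ U \ {s}, f (reachSet G (U \ {s}) x ∪ {s}) s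

/-- `s` is a leaf of the (working) tree induced on `W`. -/
def IsLeafOf (G : SimpleGraph V) (W : Set V) (s : V) : Prop :=
  s ∈ W ∧ ∃! u, u ∈ W ∧ G.Adj s u

/-- The ordered pair `(u,v)` satisfies the peaking criterion in the working tree on `W`
with sink set `S` and threshold `𝒯`. -/
def PeakingPair (G : SimpleGraph V) (f : Set V → V → ℝ≥0∞) (𝒯 : ℝ≥0∞)
    (W S : Set V) (u v : V) : Prop :=
  u ∈ W ∧ v ∈ W ∧ G.Adj u v ∧ S ∩ reachSet G (W \ {v}) u = ∅ ∧
    f (reachSet G (W \ {v}) u) u ≤ 𝒯 ∧ 𝒯 < f (reachSet G (W \ {v}) u ∪ {v}) v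

/-- `w` lies on the unique path from `a` to `b` in the tree induced on `W`. -/
def OnPath (G : SimpleGraph V) (W : Set V) (a b w : V) : Prop :=
  a ∈ W ∧ b ∈ W ∧ w ∈ W ∧ b ∉ reachSet G (W \ {w}) a

/-- Vertices of the hub tree: union of the paths from the sinks to the root `r`. -/
def hubVerts (G : SimpleGraph V) (W S : Set V) (r : V) : Set V :=
  {w | ∃ s ∈ S, OnPath G W s r w}

/-- `r` is a valid root: a non-sink vertex of the working tree such that at least two of
the subtrees hanging off it contain sinks. -/
def GoodRoot (G : SimpleGraph V) (W S : Set V) (r : V) : Prop :=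
  r ∈ W ∧ r ∉ S ∧
    ∃ η₁ η₂ : V, η₁ ≠ η₂ ∧ η₁ ∈ W ∧ η₂ ∈ W ∧ G.Adj r η₁ ∧ G.Adj r η₂ ∧
      (S ∩ reachSet G (W \ {r}) η₁).Nonempty ∧ (S ∩ reachSet G (W \ {r}) η₂).Nonempty

/-- The working tree on `W` is RC-viable w.r.t. sinks `S` and root `r`: every outstanding
branch, together with the hub-tree node it is attached to, has cost at most `𝒯`. -/
def RCViable (G : SimpleGraph V) (f : Set V → V → ℝ≥0∞) (𝒯 : ℝ≥0∞)
    (W S : Set V) (r : V) : Prop :=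
  ∀ w ∈ hubVerts G W S r, ∀ η ∈ W, G.Adj w η → η ∉ hubVerts G W S r →
    f (reachSet G (W \ {w}) η ∪ {w}) w ≤ 𝒯

/-- The set `A` is self-sufficient: it can be partitioned into subtree blocks, one for
each sink in `S ∩ A`, each block containing its sink and having cost at most `𝒯`. -/
def SelfSufficient (G : SimpleGraph V) (f : Set V → V → ℝ≥0∞) (𝒯 : ℝ≥0∞)
    (S A : Set V) : Prop :=
  ∃ P : V → Set V,
    (⋃ s ∈ S ∩ A, P s) = A ∧
    (∀ s ∈ S ∩ A, IsSubtree G (P s) ∧ s ∈ P s ∧ f (P s) s ≤ 𝒯) ∧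
    (S ∩ A).Pairwise fun s t => Disjoint (P s) (P t)

/-- The vertices of the path `Π(a,b)` in the tree induced on `W`. -/
def pathSet (G : SimpleGraph V) (W : Set V) (a b : V) : Set V :=
  {w | OnPath G W a b w}

/-- All vertices of outstanding branches attached to `w` (given hub-tree vertices `Hub`). -/
def branchesAt (G : SimpleGraph V) (W Hub : Set V) (w : V) : Set V :=
  ⋃ η ∈ {η : V | η ∈ W ∧ G.Adj w η ∧ η ∉ Hub}, reachSet G (W \ {w}) η

/-- The bulk path `BP(a,b)`: the path `Π(a,b)` together with all outstanding branches
attached to its vertices. -/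
def bulkPath (G : SimpleGraph V) (W S : Set V) (r a b : V) : Set V :=
  pathSet G W a b ∪ ⋃ w ∈ pathSet G W a b, branchesAt G W (hubVerts G W S r) w

/-- `v` is the parent of `u` in the hub tree rooted at `r`. -/
def HubParent (G : SimpleGraph V) (W S : Set V) (r u v : V) : Prop :=
  u ∈ hubVerts G W S r ∧ v ∈ hubVerts G W S r ∧ G.Adj u v ∧ OnPath G W u r v

/-- The ordered pair `(u,v)` satisfies the reaching criterion: `v` is the hub-tree parent
of `u`, `T₋ᵥ(u)` is self-sufficient, and `BP(v,v) ∪ V₋ᵥ(u)` is not self-sufficient. -/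
def ReachingPair (G : SimpleGraph V) (f : Set V → V → ℝ≥0∞) (𝒯 : ℝ≥0∞)
    (W S : Set V) (r u v : V) : Prop :=
  HubParent G W S r u v ∧
  SelfSufficient G f 𝒯 S (reachSet G (W \ {v}) u) ∧
  ¬ SelfSufficient G f 𝒯 S (bulkPath G W S r v v ∪ reachSet G (W \ {v}) u)

/-- The vertex set `V(v)` of the subtree of the working tree (rooted at `r`) rooted at `v`:
all vertices whose path to the root passes through `v`. -/
def rootedBelow (G : SimpleGraph V) (W : Set V) (r v : V) : Set V :=
  {x | OnPath G W x r v}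

/-- The rooted subtree `T(v)` is RC-viable: every outstanding branch attached to a
hub-tree node lying in `T(v)` has, together with its attachment node, cost at most `𝒯`. -/
def RCViableBelow (G : SimpleGraph V) (f : Set V → V → ℝ≥0∞) (𝒯 : ℝ≥0∞)
    (W S : Set V) (r v : V) : Prop :=
  ∀ w ∈ hubVerts G W S r ∩ rootedBelow G W r v, ∀ η ∈ W, G.Adj w η →
    η ∉ hubVerts G W S r → f (reachSet G (W \ {w}) η ∪ {w}) w ≤ 𝒯

/-- The subtree with vertex set `A` (of the working tree rooted at `r`) is recursively
self-sufficient: for every hub-tree node `w` in `A`, the part of `A` lying below `w`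
is self-sufficient. -/
def RecursivelySelfSufficientOn (G : SimpleGraph V) (f : Set V → V → ℝ≥0∞) (𝒯 : ℝ≥0∞)
    (W S : Set V) (r : V) (A : Set V) : Prop :=
  ∀ w ∈ hubVerts G W S r ∩ A, SelfSufficient G f 𝒯 S (rootedBelow G W r w ∩ A)

/-- A feasible sink configuration: a partition of all of `V_in` into subtree blocks,
one per sink, each block containing exactly its own sink and having cost at most `𝒯`. -/
def IsFeasibleConfig (G : SimpleGraph V) (f : Set V → V → ℝ≥0∞) (𝒯 : ℝ≥0∞)
    (St : Set V) (P : V → Set V) : Prop :=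
  (⋃ s ∈ St, P s) = Set.univ ∧
  St.Pairwise (fun s t => Disjoint (P s) (P t)) ∧
  ∀ s ∈ St, IsSubtree G (P s) ∧ St ∩ P s = {s} ∧ f (P s) s ≤ 𝒯

/-- An optimal feasible sink configuration: one with the minimum number of sinks. -/
def IsOptimalConfig (G : SimpleGraph V) (f : Set V → V → ℝ≥0∞) (𝒯 : ℝ≥0∞)
    (St : Set V) (P : V → Set V) : Prop :=
  IsFeasibleConfig G f 𝒯 St P ∧
  ∀ (St' : Set V) (P' : V → Set V), IsFeasibleConfig G f 𝒯 St' P' → St.ncard ≤ St'.ncard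

/-- A partial sink configuration relative to the working tree on `W`: pairwise disjoint
subtree blocks of cost at most `𝒯`, one per sink of `Sout`, covering `V_in \ (W \ Sout)`. -/
def IsPartialConfig (G : SimpleGraph V) (f : Set V → V → ℝ≥0∞) (𝒯 : ℝ≥0∞)
    (W : Set V) (Sout : Set V) (P : V → Set V) : Prop :=
  Sout.Pairwise (fun s t => Disjoint (P s) (P t)) ∧
  (∀ s ∈ Sout, IsSubtree G (P s) ∧ s ∈ P s ∧ f (P s) s ≤ 𝒯) ∧
  (⋃ s ∈ Sout, P s) = Set.univ \ (W \ Sout)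

/-- `(St, Pt)` is an optimal feasible sink configuration witnessing the optimality of the
partial configuration `(Sout, P)` relative to the working tree on `W` (conditions (C1)-(C3)). -/
def WitnessesOptimality (G : SimpleGraph V) (f : Set V → V → ℝ≥0∞) (𝒯 : ℝ≥0∞)
    (W : Set V) (Sout : Set V) (P : V → Set V) (St : Set V) (Pt : V → Set V) : Prop :=
  IsOptimalConfig G f 𝒯 St Pt ∧
  Sout ⊆ St ∧
  St \ W = Sout \ W ∧
  (∀ s ∈ Sout ∩ W, IsLeafOf G W s) ∧
  (∀ s ∈ St, s ∉ W → Pt s = P s ∧ Pt s ∩ W = ∅) ∧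
  (∀ s ∈ Sout ∩ W, P s ⊆ Pt s ∧ Pt s \ P s ⊆ W) ∧
  (∀ s ∈ St, s ∉ Sout → Pt s ⊆ W)

/-- The partial sink configuration `(Sout, P)` is optimal relative to the working tree on `W`. -/
def OptimalRelative (G : SimpleGraph V) (f : Set V → V → ℝ≥0∞) (𝒯 : ℝ≥0∞)
    (W : Set V) (Sout : Set V) (P : V → Set V) : Prop :=
  ∃ (St : Set V) (Pt : V → Set V), WitnessesOptimality G f 𝒯 W Sout P St Pt

lemma mem_reachSet_self {G : SimpleGraph V} {A : Set V} {u : V} (hu : u ∈ A) :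
    u ∈ reachSet G A u :=
  ⟨hu, hu, Reachable.refl _⟩

lemma reachSet_subset (G : SimpleGraph V) (A : Set V) (u : V) : reachSet G A u ⊆ A :=
  fun _ ⟨_, hy, _⟩ => hy

lemma mem_reachSet_of_adj {G : SimpleGraph V} {A : Set V} {u y z : V}
    (hy : y ∈ reachSet G A u) (hz : z ∈ A) (hyz : G.Adj y z) : z ∈ reachSet G A u := by
  obtain ⟨hu, hyA, h⟩ := hy
  refine ⟨hu, hz, h.trans (Adj.reachable ?_)⟩
  exact hyz

lemma reachSet_induction {G : SimpleGraph V} {A : Set V} {u : V} {P : V → Prop}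
    (base : P u)
    (step : ∀ a b, a ∈ reachSet G A u → P a → b ∈ A → G.Adj a b → P b)
    {y : V} (hy : y ∈ reachSet G A u) : P y := by
  obtain ⟨hu, hyA, h⟩ := hy
  rw [reachable_iff_reflTransGen] at h
  have key : ∀ b : A, Relation.ReflTransGen (G.induce A).Adj ⟨u, hu⟩ b → P b := by
    intro b hb
    induction hb with
    | refl => exact base
    | @tail b c hb hbc ih =>
      exact step b c ⟨hu, b.2, (reachable_iff_reflTransGen _ _).2 hb⟩ ih c.2 hbc
  exact key _ h

lemma reachSet_mono (G : SimpleGraph V) {A B : Set V} (hAB : A ⊆ B) (u : V) :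
    reachSet G A u ⊆ reachSet G B u := fun _ hy =>
  reachSet_induction (mem_reachSet_self (hAB hy.1))
    (fun _ _ _ ha hb hab => mem_reachSet_of_adj ha (hAB hb) hab) hy

lemma reachSet_eq_of_mem {G : SimpleGraph V} {A : Set V} {x y : V}
    (hy : y ∈ reachSet G A x) : reachSet G A y = reachSet G A x := by
  obtain ⟨hx, hyA, h⟩ := hy
  ext z
  exact ⟨fun ⟨_, hz, h'⟩ => ⟨hx, hz, h.trans h'⟩, fun ⟨_, hz, h'⟩ => ⟨hyA, hz, h.symm.trans h'⟩⟩

lemma isSubtree_reachSet {G : SimpleGraph V} {A : Set V} {u : V} (hu : u ∈ A) :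
    IsSubtree G (reachSet G A u) := by
  have key : ∀ y ∈ reachSet G A u, y ∈ reachSet G (reachSet G A u) u := fun y hy =>
    reachSet_induction (P := fun y => y ∈ reachSet G (reachSet G A u) u)
      (mem_reachSet_self (mem_reachSet_self hu))
      (fun _ _ ha ha' hb hab => mem_reachSet_of_adj ha' (mem_reachSet_of_adj ha hb hab) hab) hy
  refine (connected_iff_exists_forall_reachable _).2 ⟨⟨u, mem_reachSet_self hu⟩, ?_⟩
  rintro ⟨y, hy⟩
  obtain ⟨_, _, h⟩ := key y hy
  exact h

/-- Every component of `A \ {u}`, for a subtree `A`, contains a neighbour of `u`. -/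
lemma exists_adj_mem_reachSet {G : SimpleGraph V} {A : Set V} (hA : IsSubtree G A) {u x : V}
    (hu : u ∈ A) (hx : x ∈ A \ {u}) : ∃ y ∈ reachSet G (A \ {u}) x, G.Adj u y := by
  by_contra! hno
  have hux : u ∈ reachSet G A x := ⟨hx.1, hu, hA.preconnected _ _⟩
  have : u ∈ reachSet G (A \ {u}) x := by
    refine reachSet_induction (P := fun y => y ∈ reachSet G (A \ {u}) x)
      (mem_reachSet_self hx) (fun a b _ ha hb hab => ?_) hux
    refine mem_reachSet_of_adj ha ⟨hb, ?_⟩ hab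
    rintro rfl
    exact hno a ha hab.symm
  exact (reachSet_subset _ _ _ this).2 rfl

/-- In an acyclic graph, `u` is the only neighbour of `v` in its component of `W \ {v}`. -/
lemma eq_of_adj_of_mem_reachSet {G : SimpleGraph V} (hG : G.IsAcyclic) {W : Set V} {u v y : V}
    (huv : G.Adj u v) (hy : y ∈ reachSet G (W \ {v}) u) (hyv : G.Adj y v) : y = u := by
  by_contra hne
  have hb := isBridge_iff.1 (isAcyclic_iff_forall_adj_isBridge.1 hG huv)
  have key : (G \ fromEdgeSet {s(u, v)}).Reachable u y := by
    refine reachSet_induction (P := fun y => (G \ fromEdgeSet {s(u, v)}).Reachable u y)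
      (Reachable.refl _) (fun a b ha h hbW hab => h.trans (Adj.reachable ?_)) hy
    have hav : a ≠ v := (reachSet_subset _ _ _ ha).2
    have hbv : b ≠ v := hbW.2
    simp [hab, hav, hbv]
  refine hb (key.trans (Adj.reachable ?_))
  simp [hyv, hne, huv.ne']

lemma reachSet_diff_eq {G : SimpleGraph V} (hG : G.IsAcyclic) {W : Set V} {u v x : V}
    (huv : G.Adj u v) (hx : x ∈ reachSet G (W \ {v}) u \ {u}) :
    reachSet G (reachSet G (W \ {v}) u \ {u}) x = reachSet G (W \ {u}) x := by
  refine Subset.antisymm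
    (reachSet_mono G (sdiff_subset_sdiff_left ((reachSet_subset _ _ _).trans sdiff_subset)) x) ?_
  intro y hy
  refine reachSet_induction
    (P := fun y => y ∈ reachSet G (reachSet G (W \ {v}) u \ {u}) x)
    (mem_reachSet_self hx) (fun a b _ ha hb hab => ?_) hy
  have haR := reachSet_subset _ _ _ ha
  refine mem_reachSet_of_adj ha ⟨mem_reachSet_of_adj haR.1 ⟨hb.1, ?_⟩ hab, hb.2⟩ hab
  rintro rfl
  exact haR.2 (eq_of_adj_of_mem_reachSet hG huv haR.1 hab)

/-- Without peaking pairs, every branch avoiding the sinks, together with the vertex it is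
attached to, has cost at most `𝒯`. -/
lemma branch_cost_le [Finite V] {G : SimpleGraph V} (hG : G.IsAcyclic)
    {f : Set V → V → ℝ≥0∞} (hf : IsMinmaxMonotone G f) {𝒯 : ℝ≥0∞} {W S : Set V}
    (hnopeak : ∀ u v : V, ¬ PeakingPair G f 𝒯 W S u v) {u v : V} (hu : u ∈ W) (hv : v ∈ W)
    (huv : G.Adj u v) (hS : S ∩ reachSet G (W \ {v}) u = ∅) :
    f (reachSet G (W \ {v}) u ∪ {v}) v ≤ 𝒯 := by
  induction hn : (reachSet G (W \ {v}) u).ncard using Nat.strong_induction_on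
    generalizing u v with
  | _ n ih =>
  subst hn
  by_contra! hlt
  refine hnopeak u v ⟨hu, hv, huv, hS, ?_, hlt⟩
  have huA : u ∈ W \ {v} := ⟨hu, huv.ne⟩
  have huR := mem_reachSet_self (G := G) huA
  have hR := isSubtree_reachSet (G := G) huA
  rw [hf.max_comp _ u hR huR]
  refine iSup₂_le fun x hx => ?_
  obtain ⟨y, hy, huy⟩ := exists_adj_mem_reachSet hR huR hx
  have hyR := reachSet_subset _ _ _ hy
  have hsub : reachSet G (W \ {u}) y ⊆ reachSet G (W \ {v}) u \ {u} := by
    rw [← reachSet_diff_eq hG huv hyR]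
    exact reachSet_subset _ _ _
  rw [← reachSet_eq_of_mem hy, reachSet_diff_eq hG huv hyR]
  refine ih _ (ncard_lt_ncard ?_ (toFinite _)) (reachSet_subset _ _ _ hyR.1).1 hu huy.symm
    (subset_empty_iff.1 (hS ▸ inter_subset_inter_right S (hsub.trans sdiff_subset))) rfl
  exact (ssubset_iff_of_subset (hsub.trans sdiff_subset)).2 ⟨u, huR, fun h => (hsub h).2 rfl⟩

/-- if no ordered pair satisfies the peaking criterion and `S = {s}`, then
`f(V, s) ≤ 𝒯`. -/
theorem statement_2 [Fintype V] (G : SimpleGraph V) (hG : G.IsTree)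
    (f : Set V → V → ℝ≥0∞) (hf : IsMinmaxMonotone G f) (𝒯 : ℝ≥0∞)
    (W S : Set V) (hW : IsSubtree G W) (hSW : S ⊆ W)
    (hSleaf : ∀ s ∈ S, IsLeafOf G W s)
    (hnopeak : ∀ u v : V, ¬ PeakingPair G f 𝒯 W S u v)
    (s : V) (hSsingle : S = {s}) :
    f W s ≤ 𝒯 := by
  subst hSsingle
  have hs : s ∈ W := hSW rfl
  rw [hf.max_comp W s hW hs]
  refine iSup₂_le fun x hx => ?_
  obtain ⟨y, hy, hsy⟩ := exists_adj_mem_reachSet hW hs hx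
  rw [← reachSet_eq_of_mem hy]
  refine branch_cost_le hG.isAcyclic hf hnopeak (reachSet_subset _ _ _ hy).1 hs hsy.symm ?_
  exact singleton_inter_eq_empty.2 fun h => (reachSet_subset _ _ _ h).2 rfl
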